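/- Let ρ : (0,∞) → (0,∞) satisfy d₁ξ^{-1/2} ≤ ρ(ξ) ≤ d₂ξ^{-1/2} for ξ ≤ 1 and d₁ξ^{1/2} ≤ ρ(ξ) ≤ d₂ξ^{1/2} for ξ ≥ 1. Let F : (0,∞)² → ℝ be symmetric and satisfy, for each N ∈ ℕ, |F(ξ,η)| ≤ C_N(ξ+η) for ξ+η ≤ 1 and |F(ξ,η)| ≤ C_N (ξ+η)^{-1}(1+|ξ^{1/2}−η^{1/2}|)^{-N} for ξ+η ≥ 1. Set K_cc(ξ,η) := ρ(η)F(ξ,η)/(ξ−η). Fix a smooth cutoff χ with χ = 1 on [−1,1] and χ = 0 outside [−2,2], and for n₀ ∈ ℕ let K^{nd}_{n₀}(ξ,η) := (1 − χ(n₀(ξ/η − 1))) K_cc(ξ,η) with associated operator 𝓚^{nd}_{n₀} f(ξ) := ∫₀^∞ K^{nd}_{n₀}(ξ,η) f(η) dη. Let δ > 0 be sufficiently small and p sufficiently large (in particular (−1+δ)p/(p−1) > −1). Then ‖ |·|^{-1/(2p)} ⟨·⟩^{1/(2p)} 𝓚^{nd}_{n₀} f ‖_Y ≤ C n₀² ‖f‖_Y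 and ‖ |·|^{-1/(2p)} ⟨·⟩^{1/(2p)} 𝓚^{nd}_{n₀} f ‖_X ≤ C n₀⁴ ‖f‖_X for all n₀ ≥ 100. -/

import Mathlib

open MeasureTheory

noncomputable section

/-- The Japanese bracket `⟨ξ⟩ = (1+ξ²)^{1/2}`. -/
def jb (ξ : ℝ) : ℝ := (1 + ξ ^ 2) ^ ((1 : ℝ) / 2)

/-- The transference kernel `K_cc(ξ,η) = ρ(η) F(ξ,η)/(ξ−η)`. -/
def Kcc (ρ : ℝ → ℝ) (F : ℝ → ℝ → ℝ) (ξ η : ℝ) : ℝ := ρ η * F ξ η / (ξ - η)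

/-- The off-diagonal part `K^{nd}_{n₀}` of the transference kernel. -/
def Knd (χ ρ : ℝ → ℝ) (F : ℝ → ℝ → ℝ) (n₀ : ℕ) (ξ η : ℝ) : ℝ :=
  (1 - χ ((n₀ : ℝ) * (ξ / η - 1))) * Kcc ρ F ξ η

/-- The off-diagonal operator `𝓚^{nd}_{n₀}`. -/
def KndOp (χ ρ : ℝ → ℝ) (F : ℝ → ℝ → ℝ) (n₀ : ℕ) (f : ℝ → ℝ) (ξ : ℝ) : ℝ :=
  ∫ η in Set.Ioi (0 : ℝ), Knd χ ρ F n₀ ξ η * f η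

/-- The norm `‖f‖_Y`. -/
def Ynorm (ρ : ℝ → ℝ) (p : ℝ) (f : ℝ → ℝ) : ENNReal :=
  eLpNorm f (ENNReal.ofReal p) (volume.restrict (Set.Ioi 0)) +
  eLpNorm (fun ξ => jb ξ ^ ((1 : ℝ) / 8) * f ξ) 2
    ((volume.restrict (Set.Ioi 0)).withDensity fun ξ => ENNReal.ofReal (ρ ξ))

/-- The norm `‖f‖_X`. -/
def Xnorm (ρ : ℝ → ℝ) (p δ : ℝ) (f : ℝ → ℝ) : ENNReal :=
  eLpNorm (fun ξ => (|ξ| / jb ξ) ^ ((1 : ℝ) / 2 - δ) * f ξ)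
    (ENNReal.ofReal p) (volume.restrict (Set.Ioi 0)) +
  eLpNorm (fun ξ => |ξ| ^ ((1 : ℝ) / 2) * jb ξ ^ ((1 : ℝ) / 8) * f ξ) 2
    ((volume.restrict (Set.Ioi 0)).withDensity fun ξ => ENNReal.ofReal (ρ ξ))

lemma offDiagonal_sum_le {n ξ η : ℝ} (hn : 1 ≤ n) (hη : 0 < η) (h : 1 < |n * (ξ / η - 1)|) :
    ξ + η ≤ 3 * n * |ξ - η| := by
  have h1 : η < n * |ξ - η| := by
    have : ξ / η - 1 = (ξ - η) / η := by field_simp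
    rw [this, abs_mul, abs_div, abs_of_pos hη, abs_of_pos (by linarith : 0 < n), ← mul_div_assoc,
      lt_div_iff₀ hη] at h
    linarith
  have h2 := le_abs_self (ξ - η)
  have h3 : |ξ - η| ≤ n * |ξ - η| := le_mul_of_one_le_left (abs_nonneg _) hn
  linarith

lemma Kcc_numerator_bound {F c n ξ η : ℝ} (hn : 1 ≤ n) (hξ : 0 < ξ) (hη : 0 < η) (hc : 0 ≤ c)
    (hlow : ξ + η ≤ 1 → |F| ≤ c * (ξ + η))
    (hhigh : 1 ≤ ξ + η → |F| ≤ c * (ξ + η)⁻¹ * (1 + |√ξ - √η|)⁻¹)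
    (hoff : ξ + η ≤ 3 * n * |ξ - η|) :
    |F| * (1 + (ξ + η)) ^ ((5 : ℝ) / 2) ≤ 200 * c * n ^ 2 * |ξ - η| := by
  set s := ξ + η with hs
  have hs0 : 0 < s := by positivity
  set d := |ξ - η| with hd
  have hd0 : 0 ≤ d := abs_nonneg _
  have h2 : (2 : ℝ) ^ ((5 : ℝ) / 2) ≤ 6 := by
    rw [show (5 : ℝ) / 2 = 2 + 1 / 2 by norm_num, Real.rpow_add two_pos, ← Real.sqrt_eq_rpow]
    have : √2 ≤ 3 / 2 := Real.sqrt_le_iff.2 (by norm_num)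
    norm_num
    linarith
  have hnn : n ≤ n ^ 2 := by nlinarith
  rcases le_total s 1 with h1 | h1
  · have hT : (1 + s) ^ ((5 : ℝ) / 2) ≤ 6 :=
      (Real.rpow_le_rpow (by positivity) (by linarith) (by norm_num)).trans h2
    calc |F| * (1 + s) ^ ((5 : ℝ) / 2) ≤ (c * (3 * n * d)) * 6 := by
          gcongr
          exact (hlow h1).trans (by gcongr)
      _ = 18 * c * d * n := by ring
      _ ≤ 200 * c * d * n ^ 2 := by gcongr; norm_num
      _ = _ := by ring
  · set r := |√ξ - √η| with hr
    have hr0 : 0 ≤ r := abs_nonneg _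
    have hdr : d ≤ r * (2 * √s) := by
      have : d = r * (√ξ + √η) := by
        rw [hd, hr, ← abs_of_pos (show 0 < √ξ + √η by positivity), ← abs_mul]
        congr 1
        nlinarith [Real.mul_self_sqrt hξ.le, Real.mul_self_sqrt hη.le]
      rw [this]
      gcongr
      have := Real.sqrt_le_sqrt (show ξ ≤ s by linarith)
      have := Real.sqrt_le_sqrt (show η ≤ s by linarith)
      linarith
    have hss : √s * √s = s := Real.mul_self_sqrt hs0.le
    have hsq : 0 < √s := by positivity
    have h6 : √s ≤ 6 * n * (1 + r) := by
      have h3 : √s * √s ≤ (6 * n * r) * √s := by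
        rw [hss]
        calc s ≤ 3 * n * d := hoff
          _ ≤ 3 * n * (r * (2 * √s)) := by gcongr
          _ = _ := by ring
      have := le_of_mul_le_mul_right h3 hsq
      nlinarith
    have hT : (1 + s) ^ ((5 : ℝ) / 2) ≤ 6 * (s ^ 2 * √s) := by
      calc (1 + s) ^ ((5 : ℝ) / 2) ≤ (2 * s) ^ ((5 : ℝ) / 2) :=
            Real.rpow_le_rpow (by positivity) (by linarith) (by norm_num)
        _ = 2 ^ ((5 : ℝ) / 2) * (s ^ 2 * √s) := by
            rw [Real.mul_rpow two_pos.le hs0.le]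
            congr 1
            rw [show (5 : ℝ) / 2 = 2 + 1 / 2 by norm_num, Real.rpow_add hs0, ← Real.sqrt_eq_rpow]
            norm_num
        _ ≤ _ := by gcongr
    calc |F| * (1 + s) ^ ((5 : ℝ) / 2) ≤ (c * s⁻¹ * (1 + r)⁻¹) * (6 * (s ^ 2 * √s)) := by
          gcongr
          exact hhigh h1
      _ = 6 * c * s * (√s * (1 + r)⁻¹) := by field_simp
      _ ≤ 6 * c * (3 * n * d) * (6 * n) := by
          have : √s * (1 + r)⁻¹ ≤ 6 * n := by
            rw [← div_eq_mul_inv, div_le_iff₀ (by positivity)]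
            exact h6
          gcongr
      _ = 108 * c * n ^ 2 * d := by ring
      _ ≤ _ := by gcongr; norm_num

lemma Knd_bound {χ ρ : ℝ → ℝ} {F : ℝ → ℝ → ℝ} {M c d₂ ξ η : ℝ} {n₀ : ℕ} (hn : 1 ≤ n₀)
    (hξ : 0 < ξ) (hη : 0 < η) (hc : 0 ≤ c) (hd₂ : 0 ≤ d₂)
    (hM : ∀ x, |1 - χ x| ≤ M) (hχ1 : ∀ x : ℝ, |x| ≤ 1 → χ x = 1)
    (hρ : |ρ η| ≤ d₂ * (η ^ (-(1 : ℝ) / 2) * (1 + η)))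
    (hlow : ξ + η ≤ 1 → |F ξ η| ≤ c * (ξ + η))
    (hhigh : 1 ≤ ξ + η → |F ξ η| ≤ c * (ξ + η)⁻¹ * (1 + |√ξ - √η|)⁻¹) :
    |Knd χ ρ F n₀ ξ η| ≤
      (M * d₂ * 200 * c * (n₀ : ℝ) ^ 2 * (1 + ξ) ^ (-(3 : ℝ) / 2)) * η ^ (-(1 : ℝ) / 2) := by
  have hM0 : 0 ≤ M := (abs_nonneg _).trans (hM 0)
  unfold Knd Kcc
  rcases le_or_gt |(n₀ : ℝ) * (ξ / η - 1)| 1 with h | h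
  · rw [hχ1 _ h]
    simp only [sub_self, zero_mul, abs_zero]
    positivity
  have hn' : (1 : ℝ) ≤ n₀ := by exact_mod_cast hn
  have hoff := offDiagonal_sum_le hn' hη h
  have hd0 : 0 < |ξ - η| := by
    by_contra h0
    have : |ξ - η| = 0 := le_antisymm (not_lt.1 h0) (abs_nonneg _)
    rw [this] at hoff
    linarith
  have key := Kcc_numerator_bound hn' hξ hη hc hlow hhigh hoff
  have hT : (1 + ξ) ^ ((3 : ℝ) / 2) * (1 + η) ≤ (1 + (ξ + η)) ^ ((5 : ℝ) / 2) := by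
    rw [show (5 : ℝ) / 2 = 3 / 2 + 1 by norm_num, Real.rpow_add (by positivity), Real.rpow_one]
    gcongr <;> linarith
  have hX : (0 : ℝ) < (1 + ξ) ^ ((3 : ℝ) / 2) := by positivity
  have hF : |F ξ η| / |ξ - η| * (1 + η) ≤
      200 * c * (n₀ : ℝ) ^ 2 * (1 + ξ) ^ (-(3 : ℝ) / 2) := by
    rw [show -(3 : ℝ) / 2 = -(3 / 2) by ring, Real.rpow_neg (by positivity), ← div_eq_mul_inv,
      le_div_iff₀ hX, div_mul_eq_mul_div, div_mul_eq_mul_div, div_le_iff₀ hd0]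
    refine le_trans ?_ key
    rw [mul_assoc, mul_comm (1 + η)]
    gcongr
  rw [abs_mul, abs_div, abs_mul]
  calc |1 - χ (n₀ * (ξ / η - 1))| * (|ρ η| * |F ξ η| / |ξ - η|)
      ≤ M * ((d₂ * (η ^ (-(1 : ℝ) / 2) * (1 + η))) * |F ξ η| / |ξ - η|) := by
        gcongr
        exact hM _
    _ = M * d₂ * η ^ (-(1 : ℝ) / 2) * (|F ξ η| / |ξ - η| * (1 + η)) := by ring
    _ ≤ M * d₂ * η ^ (-(1 : ℝ) / 2) *
        (200 * c * (n₀ : ℝ) ^ 2 * (1 + ξ) ^ (-(3 : ℝ) / 2)) := by gcongr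
    _ = _ := by ring

lemma lintegral_enorm_mul_le_Lp_mul_eLpNorm {α : Type*} [MeasurableSpace α] {μ : Measure α}
    {p q : ℝ} (hpq : p.HolderConjugate q) {u : α → ℝ} (hu : Measurable u) (g : α → ℝ) :
    ∫⁻ x, ‖u x‖ₑ * ‖g x‖ₑ ∂μ ≤
      (∫⁻ x, ‖u x‖ₑ ^ p ∂μ) ^ (1 / p) * eLpNorm g (ENNReal.ofReal q) μ := by
  obtain ⟨h, hm, hle, heq⟩ := exists_measurable_le_lintegral_eq μ fun x => ‖u x‖ₑ * ‖g x‖ₑ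
  have hq : 0 < q := hpq.symm.pos
  rw [heq, eLpNorm_eq_lintegral_rpow_enorm_toReal (by simpa using hq) ENNReal.ofReal_ne_top,
    ENNReal.toReal_ofReal hq.le]
  have hk : ∀ x, h x / ‖u x‖ₑ ≤ ‖g x‖ₑ := fun x =>
    ENNReal.div_le_of_le_mul (by rw [mul_comm]; exact hle x)
  have hh : h = (fun x => ‖u x‖ₑ) * fun x => h x / ‖u x‖ₑ := by
    funext x
    simp only [Pi.mul_apply]
    refine (ENNReal.mul_div_cancel' (fun h0 => ?_) (fun h0 => absurd h0 enorm_ne_top)).symm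
    have := hle x
    simpa [h0] using this
  calc ∫⁻ x, h x ∂μ = ∫⁻ x, ((fun x => ‖u x‖ₑ) * fun x => h x / ‖u x‖ₑ) x ∂μ := by rw [← hh]
    _ ≤ _ := ENNReal.lintegral_mul_le_Lp_mul_Lq μ hpq hu.enorm.aemeasurable
          (hm.div hu.enorm).aemeasurable
    _ ≤ _ := by
      gcongr with x
      exact hk x

lemma eLpNorm_le_const_mul_of_ae {α : Type*} [MeasurableSpace α] {μ : Measure α} {p : ENNReal}
    (hp0 : p ≠ 0) (hp : p ≠ ⊤) {c : ENNReal} {f g : α → ℝ} (hg : Measurable g)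
    (h : ∀ᵐ x ∂μ, ‖f x‖ₑ ≤ c * ‖g x‖ₑ) : eLpNorm f p μ ≤ c * eLpNorm g p μ := by
  have hpos : 0 < p.toReal := ENNReal.toReal_pos hp0 hp
  rw [eLpNorm_eq_lintegral_rpow_enorm_toReal hp0 hp, eLpNorm_eq_lintegral_rpow_enorm_toReal hp0 hp]
  calc (∫⁻ x, ‖f x‖ₑ ^ p.toReal ∂μ) ^ (1 / p.toReal)
      ≤ (∫⁻ x, c ^ p.toReal * ‖g x‖ₑ ^ p.toReal ∂μ) ^ (1 / p.toReal) := by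
        refine ENNReal.rpow_le_rpow (lintegral_mono_ae ?_) (by positivity)
        filter_upwards [h] with x hx
        rw [← ENNReal.mul_rpow_of_nonneg _ _ hpos.le]
        exact ENNReal.rpow_le_rpow hx hpos.le
    _ = _ := by
        rw [lintegral_const_mul _ (hg.enorm.pow_const _),
          ENNReal.mul_rpow_of_nonneg _ _ (by positivity), ← ENNReal.rpow_mul,
          mul_one_div_cancel hpos.ne', ENNReal.rpow_one]

lemma lintegral_withDensity_ofReal_le {μ : Measure ℝ} {ρ w : ℝ → ℝ} (hw : Measurable w)
    (h : ∀ᵐ x ∂μ, ρ x ≤ w x) (G : ℝ → ENNReal) :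
    ∫⁻ x, G x ∂μ.withDensity (fun x => ENNReal.ofReal (ρ x)) ≤
      ∫⁻ x, ENNReal.ofReal (w x) * G x ∂μ := by
  refine (lintegral_mono' (withDensity_mono (g := fun x => ENNReal.ofReal (w x)) ?_) le_rfl).trans
    (lintegral_withDensity_eq_lintegral_mul_non_measurable μ hw.ennreal_ofReal ?_ G).le
  · filter_upwards [h] with x hx using ENNReal.ofReal_le_ofReal hx
  · simp

lemma lintegral_ofReal_mul_le_withDensity {μ : Measure ℝ} {ρ w : ℝ → ℝ} (hw : Measurable w)
    (h : ∀ᵐ x ∂μ, w x ≤ ρ x) (G : ℝ → ENNReal) :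
    ∫⁻ x, ENNReal.ofReal (w x) * G x ∂μ ≤
      ∫⁻ x, G x ∂μ.withDensity (fun x => ENNReal.ofReal (ρ x)) := by
  refine (lintegral_withDensity_eq_lintegral_mul_non_measurable μ hw.ennreal_ofReal ?_ G).ge.trans
    (lintegral_mono' (withDensity_mono ?_) le_rfl)
  · simp
  · filter_upwards [h] with x hx using ENNReal.ofReal_le_ofReal hx

lemma setLIntegral_Ioc_rpow_lt_top {a : ℝ} (ha : -1 < a) :
    ∫⁻ x in Set.Ioc (0 : ℝ) 1, ENNReal.ofReal (x ^ a) < ⊤ :=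
  IntegrableOn.setLIntegral_lt_top
    ((intervalIntegrable_iff_integrableOn_Ioc_of_le zero_le_one).1
      (intervalIntegral.intervalIntegrable_rpow' ha))

lemma one_add_rpow_le {t b : ℝ} (ht0 : 0 ≤ t) (ht : t ≤ 1) : (1 + t) ^ b ≤ 2 ^ |b| := by
  calc (1 + t) ^ b ≤ (1 + t) ^ |b| :=
        Real.rpow_le_rpow_of_exponent_le (by linarith) (le_abs_self b)
    _ ≤ 2 ^ |b| := Real.rpow_le_rpow (by linarith) (by linarith) (abs_nonneg b)

lemma setLIntegral_Ioi_rpow_mul_one_add_rpow_lt_top {a b : ℝ} (ha : -1 < a) (hab : a + b < -1) :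
    ∫⁻ x in Set.Ioi (0 : ℝ), ENNReal.ofReal (x ^ a * (1 + x) ^ b) < ⊤ := by
  rw [← Set.Ioc_union_Ioi_eq_Ioi (zero_le_one (α := ℝ)),
    lintegral_union measurableSet_Ioi (Set.Ioc_disjoint_Ioi le_rfl)]
  have h2 : ENNReal.ofReal (2 ^ |b|) ≠ ⊤ := ENNReal.ofReal_ne_top
  refine ENNReal.add_lt_top.2 ⟨?_, ?_⟩
  · calc _ ≤ ∫⁻ x in Set.Ioc (0 : ℝ) 1, ENNReal.ofReal (2 ^ |b|) * ENNReal.ofReal (x ^ a) := by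
          refine setLIntegral_mono' measurableSet_Ioc fun x hx => ?_
          rw [← ENNReal.ofReal_mul (by positivity)]
          refine ENNReal.ofReal_le_ofReal ?_
          rw [mul_comm]
          have := Real.rpow_nonneg hx.1.le a
          gcongr
          exact one_add_rpow_le hx.1.le hx.2
      _ < ⊤ := by
          rw [lintegral_const_mul' _ _ h2]
          exact ENNReal.mul_lt_top h2.lt_top (setLIntegral_Ioc_rpow_lt_top ha)
  · calc _ ≤ ∫⁻ x in Set.Ioi (1 : ℝ), ENNReal.ofReal (2 ^ |b|) * ENNReal.ofReal (x ^ (a + b)) := by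
          refine setLIntegral_mono' measurableSet_Ioi fun x hx => ?_
          rw [← ENNReal.ofReal_mul (by positivity)]
          refine ENNReal.ofReal_le_ofReal ?_
          have hx0 : (0 : ℝ) < x := zero_lt_one.trans hx
          have h3 : (1 + x) ^ b = (1 + x⁻¹) ^ b * x ^ b := by
            rw [← Real.mul_rpow (by positivity) hx0.le]
            congr 1
            field_simp
            ring
          rw [h3, Real.rpow_add hx0, mul_left_comm]
          gcongr
          exact one_add_rpow_le (by positivity) (inv_le_one_of_one_le₀ (le_of_lt hx))
      _ < ⊤ := by
          rw [lintegral_const_mul' _ _ h2]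
          exact ENNReal.mul_lt_top h2.lt_top
            (IntegrableOn.setLIntegral_lt_top (integrableOn_Ioi_rpow_of_lt hab one_pos))

lemma one_le_jb (ξ : ℝ) : 1 ≤ jb ξ :=
  Real.one_le_rpow (by nlinarith [sq_nonneg ξ]) (by norm_num)

lemma jb_le_one_add {ξ : ℝ} (hξ : 0 ≤ ξ) : jb ξ ≤ 1 + ξ := by
  rw [jb, ← Real.sqrt_eq_rpow]
  exact Real.sqrt_le_iff.2 ⟨by linarith, by nlinarith⟩

@[fun_prop]
lemma measurable_jb : Measurable jb := by
  unfold jb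
  fun_prop

lemma le_jb (ξ : ℝ) : |ξ| ≤ jb ξ := by
  rw [jb, ← Real.sqrt_eq_rpow]
  exact Real.abs_le_sqrt (by linarith)

lemma density_bounds {d₁ d₂ : ℝ} (hd₁ : 0 < d₁) (hd : d₁ ≤ d₂) {ρ : ℝ → ℝ}
    (hρ1 : ∀ ξ : ℝ, 0 < ξ → ξ ≤ 1 →
      d₁ * ξ ^ (-(1 : ℝ) / 2) ≤ ρ ξ ∧ ρ ξ ≤ d₂ * ξ ^ (-(1 : ℝ) / 2))
    (hρ2 : ∀ ξ : ℝ, 1 ≤ ξ → d₁ * ξ ^ ((1 : ℝ) / 2) ≤ ρ ξ ∧ ρ ξ ≤ d₂ * ξ ^ ((1 : ℝ) / 2))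
    {ξ : ℝ} (hξ : 0 < ξ) :
    d₁ / 2 * (ξ ^ (-(1 : ℝ) / 2) * (1 + ξ)) ≤ ρ ξ ∧
      ρ ξ ≤ d₂ * (ξ ^ (-(1 : ℝ) / 2) * (1 + ξ)) := by
  have hx : 0 < ξ ^ (-(1 : ℝ) / 2) := Real.rpow_pos_of_pos hξ _
  rcases le_total ξ 1 with h | h
  · obtain ⟨hl, hu⟩ := hρ1 ξ hξ h
    constructor
    · refine le_trans ?_ hl
      rw [div_mul_eq_mul_div, div_le_iff₀ two_pos, mul_assoc]
      gcongr
      linarith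
    · refine hu.trans ?_
      have hd₂ : 0 ≤ d₂ := hd₁.le.trans hd
      gcongr
      exact le_mul_of_one_le_right hx.le (le_add_of_nonneg_right hξ.le)
  · obtain ⟨hl, hu⟩ := hρ2 ξ h
    have h2 : ξ ^ ((1 : ℝ) / 2) = ξ ^ (-(1 : ℝ) / 2) * ξ := by
      rw [← Real.rpow_add_one hξ.ne']
      norm_num
    rw [h2] at hl hu
    constructor
    · refine le_trans ?_ hl
      rw [div_mul_eq_mul_div, div_le_iff₀ two_pos, mul_assoc, mul_assoc]
      gcongr
      linarith
    · refine hu.trans ?_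
      have hd₂ : 0 ≤ d₂ := hd₁.le.trans hd
      gcongr
      exact le_add_of_nonneg_left zero_le_one

lemma setLIntegral_rpow_mul_enorm_le {d₁ d₂ : ℝ} (hd₁ : 0 < d₁) {ρ : ℝ → ℝ}
    (hρ : ∀ ξ : ℝ, 0 < ξ → d₁ * (ξ ^ (-(1 : ℝ) / 2) * (1 + ξ)) ≤ ρ ξ ∧
      ρ ξ ≤ d₂ * (ξ ^ (-(1 : ℝ) / 2) * (1 + ξ))) :
    ∃ A : ENNReal, A ≠ ⊤ ∧ ∀ S : Set ℝ, MeasurableSet S → S ⊆ Set.Ioi 0 →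
      ∀ v : ℝ → ℝ, (∀ x ∈ S, 1 ≤ v x) → Measurable v → ∀ f : ℝ → ℝ,
      ∫⁻ x in S, ‖x ^ (-(1 : ℝ) / 2)‖ₑ * ‖f x‖ₑ ≤ A * eLpNorm (fun x => v x * f x) 2
        ((volume.restrict (Set.Ioi 0)).withDensity fun ξ => ENNReal.ofReal (ρ ξ)) := by
  refine ⟨(∫⁻ x in Set.Ioi (0 : ℝ),
    ENNReal.ofReal (d₂ * d₁⁻¹ ^ 2) * ENNReal.ofReal (x ^ (-(1 : ℝ) / 2) * (1 + x) ^ (-1 : ℝ))) ^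
      (1 / 2 : ℝ), ?_, ?_⟩
  · refine ENNReal.rpow_ne_top_of_nonneg (by norm_num) ?_
    rw [lintegral_const_mul' _ _ ENNReal.ofReal_ne_top]
    exact ENNReal.mul_ne_top ENNReal.ofReal_ne_top
      (setLIntegral_Ioi_rpow_mul_one_add_rpow_lt_top (by norm_num) (by norm_num)).ne
  intro S hS hS0 v hv hvm f
  set μ := volume.restrict S with hμ
  set ν := μ.withDensity fun ξ => ENNReal.ofReal (ρ ξ) with hν
  have hmem : ∀ᵐ x ∂μ, x ∈ S := ae_restrict_mem hS
  let u : ℝ → ℝ := fun x => d₁⁻¹ * (1 + x)⁻¹ * (v x)⁻¹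
  have hu : Measurable u := by fun_prop
  have hνle : ν ≤ (volume.restrict (Set.Ioi 0)).withDensity fun ξ => ENNReal.ofReal (ρ ξ) := by
    rw [hν, hμ, ← Set.inter_eq_left.2 hS0, ← Measure.restrict_restrict hS,
      ← restrict_withDensity hS]
    exact Measure.restrict_le_self
  calc ∫⁻ x, ‖x ^ (-(1 : ℝ) / 2)‖ₑ * ‖f x‖ₑ ∂μ
      = ∫⁻ x, ENNReal.ofReal (d₁ * (x ^ (-(1 : ℝ) / 2) * (1 + x))) *
          (‖u x‖ₑ * ‖v x * f x‖ₑ) ∂μ := by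
        refine lintegral_congr_ae ?_
        filter_upwards [hmem] with x hx
        have hx0 : 0 < x := hS0 hx
        have hvx : 0 < v x := one_pos.trans_le (hv x hx)
        rw [← Real.enorm_of_nonneg (by positivity), ← enorm_mul, ← enorm_mul, ← enorm_mul]
        congr 1
        simp only [u]
        field_simp
    _ ≤ ∫⁻ x, ‖u x‖ₑ * ‖v x * f x‖ₑ ∂ν := by
        refine lintegral_ofReal_mul_le_withDensity (by fun_prop) ?_ _
        filter_upwards [hmem] with x hx using (hρ x (hS0 hx)).1
    _ ≤ (∫⁻ x, ‖u x‖ₑ ^ (2 : ℝ) ∂ν) ^ (1 / 2 : ℝ) *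
          eLpNorm (fun x => v x * f x) (ENNReal.ofReal 2) ν :=
        lintegral_enorm_mul_le_Lp_mul_eLpNorm Real.HolderConjugate.two_two hu _
    _ ≤ _ := by
        rw [ENNReal.ofReal_ofNat]
        gcongr ?_ ^ _ * ?_
        · refine (lintegral_withDensity_ofReal_le
            (w := fun x => d₂ * (x ^ (-(1 : ℝ) / 2) * (1 + x))) (by fun_prop) ?_ _).trans ?_
          · filter_upwards [hmem] with x hx using (hρ x (hS0 hx)).2
          refine le_trans ?_ (lintegral_mono_set hS0)
          refine setLIntegral_mono' hS fun x hx => ?_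
          have hx0 : 0 < x := hS0 hx
          have hvx := hv x hx
          have hd₂ : 0 ≤ d₂ := by
            obtain ⟨h1, h2⟩ := hρ x hx0
            exact (pos_of_mul_pos_left ((show 0 < d₁ * (x ^ (-(1 : ℝ) / 2) * (1 + x)) by
              positivity).trans_le (h1.trans h2)) (by positivity)).le
          have hu0 : 0 ≤ u x := by simp only [u]; positivity
          rw [Real.enorm_of_nonneg hu0, ENNReal.ofReal_rpow_of_nonneg hu0 (by norm_num),
            ← ENNReal.ofReal_mul (by positivity), ← ENNReal.ofReal_mul (by positivity)]
          refine ENNReal.ofReal_le_ofReal ?_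
          have h1 : (v x)⁻¹ ≤ 1 := inv_le_one_of_one_le₀ hvx
          have h2 : u x ≤ d₁⁻¹ * (1 + x)⁻¹ := mul_le_of_le_one_right (by positivity) h1
          calc d₂ * (x ^ (-(1 : ℝ) / 2) * (1 + x)) * u x ^ (2 : ℝ)
              ≤ d₂ * (x ^ (-(1 : ℝ) / 2) * (1 + x)) * (d₁⁻¹ * (1 + x)⁻¹) ^ (2 : ℝ) := by gcongr
            _ = _ := by
              rw [Real.rpow_two, Real.rpow_neg_one]
              field_simp
        · exact eLpNorm_mono_measure _ hνle

lemma setLIntegral_Ioc_rpow_mul_enorm_le {p δ : ℝ} (hp : 1 < p) (hδ0 : 0 < δ) (hδ : δ < 1 / 2)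
    (hpδ : (-1 + δ) * (p / (p - 1)) > -1) :
    ∃ A : ENNReal, A ≠ ⊤ ∧ ∀ f : ℝ → ℝ,
      ∫⁻ x in Set.Ioc 0 1, ‖x ^ (-(1 : ℝ) / 2)‖ₑ * ‖f x‖ₑ ≤
        A * eLpNorm (fun ξ => (|ξ| / jb ξ) ^ ((1 : ℝ) / 2 - δ) * f ξ)
          (ENNReal.ofReal p) (volume.restrict (Set.Ioi 0)) := by
  set q := p / (p - 1) with hq
  have hpq : q.HolderConjugate p := (Real.HolderConjugate.conjExponent hp).symm
  have hq0 : 0 < q := hpq.pos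
  refine ⟨(∫⁻ x in Set.Ioc (0 : ℝ) 1, ENNReal.ofReal (2 ^ q) * ENNReal.ofReal (x ^ ((-1 + δ) * q)))
      ^ (1 / q : ℝ), ?_, fun f => ?_⟩
  · refine ENNReal.rpow_ne_top_of_nonneg (by positivity) ?_
    rw [lintegral_const_mul' _ _ ENNReal.ofReal_ne_top]
    exact ENNReal.mul_ne_top ENNReal.ofReal_ne_top (setLIntegral_Ioc_rpow_lt_top hpδ).ne
  let u : ℝ → ℝ := fun x => x ^ (-(1 : ℝ) / 2) * (|x| / jb x) ^ (-((1 : ℝ) / 2 - δ))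
  have hu : Measurable u := by fun_prop
  calc ∫⁻ x in Set.Ioc 0 1, ‖x ^ (-(1 : ℝ) / 2)‖ₑ * ‖f x‖ₑ
      = ∫⁻ x in Set.Ioc 0 1, ‖u x‖ₑ * ‖(|x| / jb x) ^ ((1 : ℝ) / 2 - δ) * f x‖ₑ := by
        refine setLIntegral_congr_fun measurableSet_Ioc fun x hx => ?_
        have hx0 : 0 < |x| / jb x :=
          div_pos (abs_pos.2 hx.1.ne') (one_pos.trans_le (one_le_jb x))
        simp only [u]
        rw [← enorm_mul, ← enorm_mul, Real.rpow_neg hx0.le]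
        congr 1
        field_simp
    _ ≤ _ := lintegral_enorm_mul_le_Lp_mul_eLpNorm hpq hu _
    _ ≤ _ := by
        gcongr ?_ ^ _ * ?_
        · refine setLIntegral_mono' measurableSet_Ioc fun x hx => ?_
          have hx0 : 0 < x := hx.1
          have hj := one_le_jb x
          have hu0 : 0 ≤ u x := by simp only [u]; positivity
          rw [Real.enorm_of_nonneg hu0, ENNReal.ofReal_rpow_of_nonneg hu0 hq0.le,
            ← ENNReal.ofReal_mul (by positivity)]
          refine ENNReal.ofReal_le_ofReal ?_
          rw [Real.rpow_mul hx0.le, ← Real.mul_rpow (by norm_num) (by positivity)]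
          refine Real.rpow_le_rpow hu0 ?_ hq0.le
          have h1 : jb x ^ ((1 : ℝ) / 2 - δ) ≤ 2 :=
            (Real.rpow_le_rpow_of_exponent_le hj (show (1 : ℝ) / 2 - δ ≤ 1 by linarith)).trans
              (by rw [Real.rpow_one]; linarith [jb_le_one_add hx0.le, hx.2])
          calc u x = jb x ^ ((1 : ℝ) / 2 - δ) * (x ^ (-(1 : ℝ) / 2) * x ^ (-((1 : ℝ) / 2 - δ))) := by
                simp only [u]
                rw [abs_of_pos hx0, Real.div_rpow hx0.le (by positivity),
                  Real.rpow_neg (by positivity : 0 ≤ jb x)]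
                field_simp
            _ ≤ 2 * x ^ (-1 + δ) := by
                rw [← Real.rpow_add hx0, show -(1 : ℝ) / 2 + -(1 / 2 - δ) = -1 + δ by ring]
                gcongr
        · exact eLpNorm_mono_measure _ (Measure.restrict_mono Set.Ioc_subset_Ioi_self le_rfl)

lemma eLpNorm_rpow_mul_one_add_rpow_lt_top {p a b : ℝ} (hp : 0 < p) (ha : -1 < a * p)
    (hab : a * p + b * p < -1) :
    eLpNorm (fun x : ℝ => x ^ a * (1 + x) ^ b) (ENNReal.ofReal p) (volume.restrict (Set.Ioi 0))
      < ⊤ := by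
  rw [eLpNorm_eq_lintegral_rpow_enorm_toReal (by simpa using hp) ENNReal.ofReal_ne_top,
    ENNReal.toReal_ofReal hp.le]
  refine ENNReal.rpow_lt_top_of_nonneg (by positivity) (ne_of_lt ?_)
  refine lt_of_le_of_lt (le_of_eq ?_) (setLIntegral_Ioi_rpow_mul_one_add_rpow_lt_top ha hab)
  refine setLIntegral_congr_fun measurableSet_Ioi fun x hx => ?_
  have hx0 : (0 : ℝ) < x := hx
  rw [Real.enorm_of_nonneg (by positivity), ENNReal.ofReal_rpow_of_nonneg (by positivity) hp.le,
    Real.mul_rpow (by positivity) (by positivity), ← Real.rpow_mul hx0.le,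
    ← Real.rpow_mul (by positivity)]

lemma eLpNorm_two_rpow_mul_one_add_rpow_lt_top {d a b : ℝ} (ha : -(1 / 2) < a * 2)
    (hab : a * 2 + b * 2 < -(3 / 2)) {ρ : ℝ → ℝ}
    (hρ : ∀ ξ : ℝ, 0 < ξ → ρ ξ ≤ d * (ξ ^ (-(1 : ℝ) / 2) * (1 + ξ))) :
    eLpNorm (fun x : ℝ => x ^ a * (1 + x) ^ b) 2
      ((volume.restrict (Set.Ioi 0)).withDensity fun ξ => ENNReal.ofReal (ρ ξ)) < ⊤ := by
  rw [eLpNorm_eq_lintegral_rpow_enorm_toReal (by norm_num) (by norm_num), ENNReal.toReal_ofNat]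
  refine ENNReal.rpow_lt_top_of_nonneg (by norm_num) (ne_of_lt ?_)
  refine (lintegral_withDensity_ofReal_le
    (w := fun x => d * (x ^ (-(1 : ℝ) / 2) * (1 + x))) (by fun_prop) ?_ _).trans_lt ?_
  · filter_upwards [ae_restrict_mem measurableSet_Ioi] with x hx using hρ x hx
  calc _ = ∫⁻ x in Set.Ioi (0 : ℝ), ENNReal.ofReal d *
        ENNReal.ofReal (x ^ (-(1 : ℝ) / 2 + a * 2) * (1 + x) ^ (1 + b * 2)) := by
        refine setLIntegral_congr_fun measurableSet_Ioi fun x hx => ?_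
        have hx0 : (0 : ℝ) < x := hx
        rw [Real.enorm_of_nonneg (by positivity),
          ENNReal.ofReal_rpow_of_nonneg (by positivity) (by norm_num),
          ← ENNReal.ofReal_mul' (by positivity), ← ENNReal.ofReal_mul' (by positivity),
          Real.mul_rpow (by positivity) (by positivity), ← Real.rpow_mul hx0.le,
          ← Real.rpow_mul (by positivity), Real.rpow_add hx0, Real.rpow_add (by positivity),
          Real.rpow_one]
        congr 1
        ring
    _ < ⊤ := by
        rw [lintegral_const_mul' _ _ ENNReal.ofReal_ne_top]
        exact ENNReal.mul_lt_top ENNReal.ofReal_lt_top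
          (setLIntegral_Ioi_rpow_mul_one_add_rpow_lt_top (by linarith) (by linarith))

lemma eLpNorm_mul_weight_le {ν : Measure ℝ} (hν : ν ≪ volume.restrict (Set.Ioi 0)) {r c : ENNReal}
    (hr0 : r ≠ 0) (hr : r ≠ ⊤) {κ s : ℝ} (hκ : 0 ≤ κ) {m T : ℝ → ℝ}
    (hm : ∀ ξ, 0 < ξ → |m ξ| ≤ (1 + ξ) ^ s)
    (hT : ∀ ξ, 0 < ξ → ‖T ξ‖ₑ ≤ c * ‖(1 + ξ) ^ (-(3 : ℝ) / 2)‖ₑ) :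
    eLpNorm (fun ξ => m ξ * (|ξ| ^ (-κ) * jb ξ ^ κ * T ξ)) r ν ≤
      c * eLpNorm (fun ξ : ℝ => ξ ^ (-κ) * (1 + ξ) ^ (κ + s - 3 / 2)) r ν := by
  refine eLpNorm_le_const_mul_of_ae hr0 hr (by fun_prop) ?_
  filter_upwards [hν.ae_le (ae_restrict_mem measurableSet_Ioi)] with ξ hξ
  have hξ0 : (0 : ℝ) < ξ := hξ
  have hj := one_le_jb ξ
  have hW : ‖m ξ * (|ξ| ^ (-κ) * jb ξ ^ κ)‖ₑ ≤ ‖ξ ^ (-κ) * (1 + ξ) ^ (κ + s)‖ₑ := by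
    rw [← ofReal_norm, ← ofReal_norm]
    refine ENNReal.ofReal_le_ofReal ?_
    rw [Real.norm_eq_abs, Real.norm_eq_abs, abs_mul, abs_of_pos hξ0,
      abs_of_nonneg (by positivity : 0 ≤ ξ ^ (-κ) * jb ξ ^ κ),
      abs_of_nonneg (by positivity : 0 ≤ ξ ^ (-κ) * (1 + ξ) ^ (κ + s))]
    calc |m ξ| * (ξ ^ (-κ) * jb ξ ^ κ) ≤ (1 + ξ) ^ s * (ξ ^ (-κ) * (1 + ξ) ^ κ) := by
          gcongr
          · exact hm ξ hξ0
          · exact jb_le_one_add hξ0.le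
      _ = _ := by
          rw [Real.rpow_add (by positivity)]
          ring
  calc ‖m ξ * (|ξ| ^ (-κ) * jb ξ ^ κ * T ξ)‖ₑ
      = ‖m ξ * (|ξ| ^ (-κ) * jb ξ ^ κ)‖ₑ * ‖T ξ‖ₑ := by rw [← enorm_mul, mul_assoc (m ξ)]
    _ ≤ ‖ξ ^ (-κ) * (1 + ξ) ^ (κ + s)‖ₑ * (c * ‖(1 + ξ) ^ (-(3 : ℝ) / 2)‖ₑ) := by
        gcongr
        exact hT ξ hξ0
    _ = c * ‖ξ ^ (-κ) * (1 + ξ) ^ (κ + s) * (1 + ξ) ^ (-(3 : ℝ) / 2)‖ₑ := by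
        rw [enorm_mul _ ((1 + ξ) ^ (-(3 : ℝ) / 2))]
        ring
    _ = _ := by
        rw [mul_assoc, ← Real.rpow_add (by positivity)]
        ring_nf

lemma enorm_KndOp_le {χ ρ : ℝ → ℝ} {F : ℝ → ℝ → ℝ} {n₀ : ℕ} {D ξ : ℝ} (hD : 0 ≤ D)
    (h : ∀ η, 0 < η →
      |Knd χ ρ F n₀ ξ η| ≤ (D * (1 + ξ) ^ (-(3 : ℝ) / 2)) * η ^ (-(1 : ℝ) / 2)) (f : ℝ → ℝ) :
    ‖KndOp χ ρ F n₀ f ξ‖ₑ ≤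
      ENNReal.ofReal D * (∫⁻ x in Set.Ioi 0, ‖x ^ (-(1 : ℝ) / 2)‖ₑ * ‖f x‖ₑ) *
        ‖(1 + ξ) ^ (-(3 : ℝ) / 2)‖ₑ := by
  calc ‖KndOp χ ρ F n₀ f ξ‖ₑ ≤ ∫⁻ η in Set.Ioi 0, ‖Knd χ ρ F n₀ ξ η * f η‖ₑ :=
        enorm_integral_le_lintegral_enorm _
    _ ≤ ∫⁻ η in Set.Ioi 0, (‖D‖ₑ * ‖(1 + ξ) ^ (-(3 : ℝ) / 2)‖ₑ) *
          (‖η ^ (-(1 : ℝ) / 2)‖ₑ * ‖f η‖ₑ) := by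
        refine setLIntegral_mono' measurableSet_Ioi fun η hη => ?_
        have hη0 : (0 : ℝ) < η := hη
        rw [← mul_assoc, ← enorm_mul D, ← enorm_mul (D * _), enorm_mul (Knd χ ρ F n₀ ξ η)]
        gcongr
        rw [← ofReal_norm, ← ofReal_norm, Real.norm_eq_abs, Real.norm_eq_abs]
        exact ENNReal.ofReal_le_ofReal ((h η hη).trans (le_abs_self _))
    _ = _ := by
        rw [lintegral_const_mul' _ _ (ENNReal.mul_ne_top enorm_ne_top enorm_ne_top),
          Real.enorm_of_nonneg hD]
        ring

lemma exists_cutoff_bound {χ : ℝ → ℝ} (hχ : Continuous χ)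
    (hχ0 : ∀ x : ℝ, 2 ≤ |x| → χ x = 0) : ∃ M, ∀ x, |1 - χ x| ≤ M := by
  have hsupp : HasCompactSupport χ := by
    refine HasCompactSupport.intro (isCompact_Icc (a := (-2 : ℝ)) (b := 2)) fun x hx => hχ0 x ?_
    by_contra h
    exact hx (abs_le.1 (not_le.1 h).le)
  obtain ⟨M, hM⟩ := hsupp.exists_bound_of_continuous hχ
  refine ⟨1 + M, fun x => (abs_sub _ _).trans ?_⟩
  rw [abs_one]
  gcongr
  exact hM x

/-- Lemma Kccnd: smoothing bounds for the off-diagonal part of the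
transference operator. -/
theorem stmt12 (d₁ d₂ : ℝ) (hd₁ : 0 < d₁) (hd : d₁ ≤ d₂)
    (ρ : ℝ → ℝ)
    (hρ1 : ∀ ξ : ℝ, 0 < ξ → ξ ≤ 1 →
      d₁ * ξ ^ (-(1 : ℝ) / 2) ≤ ρ ξ ∧ ρ ξ ≤ d₂ * ξ ^ (-(1 : ℝ) / 2))
    (hρ2 : ∀ ξ : ℝ, 1 ≤ ξ → d₁ * ξ ^ ((1 : ℝ) / 2) ≤ ρ ξ ∧ ρ ξ ≤ d₂ * ξ ^ ((1 : ℝ) / 2))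
    (F : ℝ → ℝ → ℝ) (hFsymm : ∀ ξ η : ℝ, F ξ η = F η ξ)
    (CF : ℕ → ℝ)
    (hF : ∀ N : ℕ, ∀ ξ η : ℝ, 0 < ξ → 0 < η →
      (ξ + η ≤ 1 → |F ξ η| ≤ CF N * (ξ + η)) ∧
      (1 ≤ ξ + η → |F ξ η| ≤ CF N * (ξ + η)⁻¹ *
        (1 + |Real.sqrt ξ - Real.sqrt η|) ^ (-(N : ℝ))))
    (χ : ℝ → ℝ) (hχ : ContDiff ℝ (⊤ : ℕ∞) χ)
    (hχ1 : ∀ x : ℝ, |x| ≤ 1 → χ x = 1) (hχ0 : ∀ x : ℝ, 2 ≤ |x| → χ x = 0) :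
    ∃ δstar > (0 : ℝ), ∀ δ : ℝ, 0 < δ → δ < δstar →
    ∃ p₀ : ℝ, ∀ p : ℝ, p₀ ≤ p → 1 < p → (-1 + δ) * (p / (p - 1)) > -1 →
    ∃ C : ℝ, ∀ n₀ : ℕ, 100 ≤ n₀ → ∀ f : ℝ → ℝ,
      Ynorm ρ p (fun ξ => |ξ| ^ (-(1 / (2 * p))) * jb ξ ^ (1 / (2 * p)) *
          KndOp χ ρ F n₀ f ξ)
        ≤ ENNReal.ofReal (C * (n₀ : ℝ) ^ 2) * Ynorm ρ p f ∧
      Xnorm ρ p δ (fun ξ => |ξ| ^ (-(1 / (2 * p))) * jb ξ ^ (1 / (2 * p)) *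
          KndOp χ ρ F n₀ f ξ)
        ≤ ENNReal.ofReal (C * (n₀ : ℝ) ^ 4) * Xnorm ρ p δ f := by
  have hd₂ : 0 ≤ d₂ := hd₁.le.trans hd
  have hρ : ∀ ξ : ℝ, 0 < ξ → d₁ / 2 * (ξ ^ (-(1 : ℝ) / 2) * (1 + ξ)) ≤ ρ ξ ∧
      ρ ξ ≤ d₂ * (ξ ^ (-(1 : ℝ) / 2) * (1 + ξ)) := fun ξ hξ => density_bounds hd₁ hd hρ1 hρ2 hξ
  obtain ⟨M, hM⟩ := exists_cutoff_bound hχ.continuous hχ0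
  have hM0 : 0 ≤ M := (abs_nonneg _).trans (hM 0)
  obtain ⟨A₁, hA₁, hA₁'⟩ := setLIntegral_rpow_mul_enorm_le (half_pos hd₁) hρ
  refine ⟨1 / 2, by norm_num, fun δ hδ0 hδ => ⟨3, fun p hp3 hp1 hpδ => ?_⟩⟩
  obtain ⟨A₂, hA₂, hA₂'⟩ := setLIntegral_Ioc_rpow_mul_enorm_le hp1 hδ0 hδ hpδ
  set κ : ℝ := 1 / (2 * p) with hκ
  have hp0 : 0 < p := by linarith
  have hκ0 : 0 ≤ κ := by positivity
  have hκp : κ * p = 1 / 2 := by rw [hκ]; field_simp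
  have hκ6 : κ ≤ 1 / 6 := by nlinarith
  set μ : Measure ℝ := volume.restrict (Set.Ioi 0) with hμ
  set ν : Measure ℝ := μ.withDensity fun ξ => ENNReal.ofReal (ρ ξ) with hν
  have hνμ : ν ≪ μ := withDensity_absolutelyContinuous _ _
  set B₁ := eLpNorm (fun ξ : ℝ => ξ ^ (-κ) * (1 + ξ) ^ (κ + 0 - 3 / 2)) (ENNReal.ofReal p) μ
    with hB₁
  set B₂ := eLpNorm (fun ξ : ℝ => ξ ^ (-κ) * (1 + ξ) ^ (κ + 5 / 8 - 3 / 2)) 2 ν with hB₂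
  have hB₁' : B₁ ≠ ⊤ :=
    (eLpNorm_rpow_mul_one_add_rpow_lt_top hp0 (by linarith) (by nlinarith)).ne
  have hB₂' : B₂ ≠ ⊤ :=
    (eLpNorm_two_rpow_mul_one_add_rpow_lt_top (by linarith) (by linarith)
      fun ξ hξ => (hρ ξ hξ).2).ne
  set K := (A₁ + A₂) * (B₁ + B₂) with hK
  have hK' : K ≠ ⊤ := ENNReal.mul_ne_top (ENNReal.add_ne_top.2 ⟨hA₁, hA₂⟩)
    (ENNReal.add_ne_top.2 ⟨hB₁', hB₂'⟩)
  set C₀ := M * d₂ * 200 * |CF 1| with hC₀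
  have hC₀' : 0 ≤ C₀ := by positivity
  refine ⟨C₀ * K.toReal, fun n₀ hn f => ?_⟩
  have hn1 : 1 ≤ n₀ := by omega
  set L := ∫⁻ x in Set.Ioi 0, ‖x ^ (-(1 : ℝ) / 2)‖ₑ * ‖f x‖ₑ with hL
  set c := ENNReal.ofReal (C₀ * (n₀ : ℝ) ^ 2) * L with hc
  have hT : ∀ ξ, 0 < ξ → ‖KndOp χ ρ F n₀ f ξ‖ₑ ≤ c * ‖(1 + ξ) ^ (-(3 : ℝ) / 2)‖ₑ := by
    intro ξ hξ
    refine enorm_KndOp_le (by positivity) (fun η hη => ?_) f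
    obtain ⟨hl, hh⟩ := hF 1 ξ η hξ hη
    have hρη := hρ η hη
    have hρ0 : 0 ≤ ρ η := le_trans (by positivity) hρη.1
    refine Knd_bound hn1 hξ hη (abs_nonneg _) hd₂ hM hχ1 (by rw [abs_of_nonneg hρ0]; exact hρη.2)
      (fun h => (hl h).trans ?_) fun h => (hh h).trans ?_
    · gcongr
      exact le_abs_self _
    · rw [Nat.cast_one, Real.rpow_neg_one]
      gcongr
      exact le_abs_self _
  have hpr0 : ENNReal.ofReal p ≠ 0 := by simpa using hp0
  have hout : ∀ m v : ℝ → ℝ, (∀ ξ, 0 < ξ → |m ξ| ≤ (1 + ξ) ^ (0 : ℝ)) →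
      (∀ ξ, 0 < ξ → |v ξ| ≤ (1 + ξ) ^ ((5 : ℝ) / 8)) →
      ∀ N : ENNReal, L ≤ (A₁ + A₂) * N →
      eLpNorm (fun ξ => m ξ * (|ξ| ^ (-κ) * jb ξ ^ κ * KndOp χ ρ F n₀ f ξ)) (ENNReal.ofReal p) μ +
        eLpNorm (fun ξ => v ξ * (|ξ| ^ (-κ) * jb ξ ^ κ * KndOp χ ρ F n₀ f ξ)) 2 ν ≤
      ENNReal.ofReal (C₀ * K.toReal * (n₀ : ℝ) ^ 2) * N := by
    intro m v hm hv N hN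
    calc _ ≤ c * B₁ + c * B₂ := add_le_add
            (eLpNorm_mul_weight_le Measure.AbsolutelyContinuous.rfl hpr0 ENNReal.ofReal_ne_top hκ0
              hm hT)
            (eLpNorm_mul_weight_le hνμ (by norm_num) (by norm_num) hκ0 hv hT)
      _ ≤ ENNReal.ofReal (C₀ * (n₀ : ℝ) ^ 2) * ((A₁ + A₂) * N) * (B₁ + B₂) := by
          rw [← mul_add, hc]
          gcongr
      _ = ENNReal.ofReal (C₀ * (n₀ : ℝ) ^ 2) * K * N := by rw [hK]; ring
      _ = _ := by
          rw [← ENNReal.ofReal_toReal hK', ← ENNReal.ofReal_mul (by positivity),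
            ENNReal.toReal_ofReal ENNReal.toReal_nonneg]
          ring_nf
  constructor
  · have hN : L ≤ (A₁ + A₂) * Ynorm ρ p f := by
      refine (hA₁' _ measurableSet_Ioi le_rfl (fun ξ => jb ξ ^ ((1 : ℝ) / 8))
        (fun ξ _ => Real.one_le_rpow (one_le_jb ξ) (by norm_num)) (by fun_prop) f).trans ?_
      exact mul_le_mul' le_self_add le_add_self
    have := hout (fun _ => 1) (fun ξ => jb ξ ^ ((1 : ℝ) / 8)) (by simp) (fun ξ hξ => ?_) _ hN
    · simp only [one_mul] at this
      exact this
    · have hj := one_le_jb ξ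
      rw [abs_of_nonneg (by positivity)]
      exact (Real.rpow_le_rpow (by positivity) (jb_le_one_add hξ.le) (by norm_num)).trans
        (Real.rpow_le_rpow_of_exponent_le (by linarith) (by norm_num))
  · have hN : L ≤ (A₁ + A₂) * Xnorm ρ p δ f := by
      rw [hL, ← Set.Ioc_union_Ioi_eq_Ioi (zero_le_one (α := ℝ)),
        lintegral_union measurableSet_Ioi (Set.Ioc_disjoint_Ioi le_rfl), add_mul, add_comm]
      refine add_le_add ((hA₁' _ measurableSet_Ioi (Set.Ioi_subset_Ioi zero_le_one)
        (fun ξ => |ξ| ^ ((1 : ℝ) / 2) * jb ξ ^ ((1 : ℝ) / 8)) (fun ξ hξ => ?_)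
          (by fun_prop) f).trans ?_) ((hA₂' f).trans ?_)
      · exact one_le_mul_of_one_le_of_one_le
          (Real.one_le_rpow ((le_of_lt hξ).trans (le_abs_self ξ)) (by norm_num))
          (Real.one_le_rpow (one_le_jb ξ) (by norm_num))
      · exact mul_le_mul' le_rfl le_add_self
      · exact mul_le_mul' le_rfl le_self_add
    refine (hout (fun ξ => (|ξ| / jb ξ) ^ ((1 : ℝ) / 2 - δ))
      (fun ξ => |ξ| ^ ((1 : ℝ) / 2) * jb ξ ^ ((1 : ℝ) / 8)) (fun ξ hξ => ?_) (fun ξ hξ => ?_) _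
      hN).trans ?_
    · have hj := one_le_jb ξ
      rw [Real.rpow_zero, abs_of_nonneg (by positivity)]
      exact Real.rpow_le_one (by positivity) (div_le_one_of_le₀ (le_jb ξ) (by positivity))
        (by linarith)
    · have hj := one_le_jb ξ
      rw [abs_of_nonneg (by positivity), abs_of_pos hξ,
        show (5 : ℝ) / 8 = 1 / 2 + 1 / 8 by norm_num, Real.rpow_add (by positivity)]
      gcongr
      · linarith
      · exact jb_le_one_add hξ.le
    · gcongr
      · exact_mod_cast hn1
      · norm_num
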